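/- Fix an integer k ≥ 3 and set M = M(N) := ⌊N^(1/k)⌋. Then for every ε > 0 there exists N₀ such that for all N ≥ N₀, the number of pairs (x,w) ∈ (ℤ/Nℤ)ᵏ × (ℤ/Nℤ) with η^x_w ≥ 5 is at most (π²/96 + ε) · N^(k+1). -/

import Mathlib

/-- `η^x_w` is the number of `b ∈ {0,…,M-1}^k` with `b₁x₁ + ⋯ + b_kx_k ≡ w (mod N)`. -/
def eta (N M k : ℕ) (x : Fin k → ZMod N) (w : ZMod N) : ℕ :=
  (Finset.univ.filter
    (fun b : Fin k → Fin M => ∑ i, ((b i : ℕ) : ZMod N) * x i = w)).card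

/-- `Mfl k N = ⌊N^(1/k)⌋`, the integer part of the real `k`-th root of `N`. -/
noncomputable def Mfl (k N : ℕ) : ℕ := Nat.floor ((N : ℝ) ^ ((1 : ℝ) / k))

open Filter Topology

theorem exists_dvd_card_linear_eq_zero_le {N k : ℕ} [NeZero N] (v : Fin k → ZMod N) :
    ∃ d : ℕ, d ∣ N ∧ (∀ i, (d : ZMod N) ∣ v i) ∧
      (Finset.univ.filter fun x : Fin k → ZMod N => ∑ i, v i * x i = 0).card * N ≤ N ^ k * d := by
  have : IsPrincipalIdealRing (ZMod N) :=
    IsPrincipalIdealRing.of_surjective (Int.castRingHom (ZMod N)) ZMod.intCast_surjective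
  let f : (Fin k → ZMod N) →ₗ[ZMod N] ZMod N := ∑ i, v i • LinearMap.proj i
  have hf : ∀ x, f x = ∑ i, v i * x i := fun x => by simp [f]
  obtain ⟨a, ha⟩ := (IsPrincipalIdealRing.principal (LinearMap.range f)).principal
  have hd : N.gcd a.val ∣ N := Nat.gcd_dvd_left _ _
  refine ⟨N.gcd a.val, hd, fun i => ?_, ?_⟩
  · have hv : v i ∈ LinearMap.range f := ⟨Pi.single i 1, by simp [hf, Pi.single_apply]⟩
    rw [ha, ← Ideal.span, Ideal.mem_span_singleton] at hv
    refine dvd_trans ?_ hv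
    have := Nat.cast_dvd_cast (α := ZMod N) (Nat.gcd_dvd_right N a.val)
    rwa [ZMod.natCast_zmod_val] at this
  · have hcard := f.toAddMonoidHom.ker.card_mul_index
    rw [AddSubgroup.index_ker] at hcard
    have hker : Nat.card f.toAddMonoidHom.ker =
        (Finset.univ.filter fun x : Fin k → ZMod N => ∑ i, v i * x i = 0).card := by
      rw [Nat.card_eq_fintype_card, Fintype.card_subtype]
      congr 1
      ext x
      simp [AddMonoidHom.mem_ker, hf]
    have hle : AddSubgroup.zmultiples a ≤ f.toAddMonoidHom.range := by
      rw [AddSubgroup.zmultiples_le]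
      have : a ∈ LinearMap.range f := by
        rw [ha]; exact Submodule.mem_span_singleton_self a
      obtain ⟨x, hx⟩ := this
      exact ⟨x, hx⟩
    have hord := AddSubgroup.card_le_of_le hle
    rw [Nat.card_zmultiples] at hord
    have hao := ZMod.addOrderOf_coe a.val (NeZero.ne N)
    rw [ZMod.natCast_zmod_val] at hao
    rw [hao] at hord
    rw [hker] at hcard
    have hpow : Nat.card (Fin k → ZMod N) = N ^ k := by simp
    rw [hpow] at hcard
    rw [← hcard, mul_assoc]
    refine Nat.mul_le_mul_left _ ?_
    calc N = N / N.gcd a.val * N.gcd a.val := (Nat.div_mul_cancel hd).symm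
      _ ≤ _ := Nat.mul_le_mul_right _ hord

theorem card_forall_modEq_le {M k e : ℕ} (he : 0 < e) (b : Fin k → Fin M) :
    (Finset.univ.filter fun c : Fin k → Fin M => ∀ i, (c i : ℕ) ≡ b i [MOD e]).card ≤
      (M / e + 1) ^ k := by
  have h1 : (Finset.univ.filter fun c : Fin k → Fin M => ∀ i, (c i : ℕ) ≡ b i [MOD e]) =
      Fintype.piFinset fun i => Finset.univ.filter fun q : Fin M => (q : ℕ) ≡ b i [MOD e] := by
    ext c; simp
  rw [h1, Fintype.card_piFinset]
  refine (Finset.prod_le_pow_card _ _ (M / e + 1) fun i _ => ?_).trans (by simp)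
  calc _ = ((Finset.univ.filter fun q : Fin M => (q : ℕ) ≡ b i [MOD e]).map
        Fin.valEmbedding).card := (Finset.card_map _).symm
    _ ≤ ((Finset.range M).filter (· ≡ b i [MOD e])).card := by
        refine Finset.card_le_card fun q hq => ?_
        simp only [Finset.mem_map, Finset.mem_filter, Finset.mem_univ, true_and] at hq
        obtain ⟨r, hr, rfl⟩ := hq
        simpa using hr
    _ = M / e + if (b i : ℕ) % e < M % e then 1 else 0 := by
        rw [← Nat.count_eq_card_filter_range, Nat.count_modEq_card _ he]
    _ ≤ M / e + 1 := by split_ifs <;> omega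

theorem card_eq_le_sum {N M k : ℕ} [NeZero N] {b c : Fin k → Fin M} (hbc : b ≠ c) :
    (Finset.univ.filter fun x : Fin k → ZMod N =>
      ∑ i, ((b i : ℕ) : ZMod N) * x i = ∑ i, ((c i : ℕ) : ZMod N) * x i).card * N ≤
      N ^ k * ∑ e ∈ Finset.Ico 1 M, if ∀ i, (c i : ℕ) ≡ b i [MOD e] then e else 0 := by
  obtain ⟨d, hdN, hdv, hd⟩ := exists_dvd_card_linear_eq_zero_le (N := N)
    (fun i => ((b i : ℕ) : ZMod N) - ((c i : ℕ) : ZMod N))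
  have hmod : ∀ i, (c i : ℕ) ≡ b i [MOD d] := fun i => by
    obtain ⟨t, ht⟩ := hdv i
    have h0 : (((b i : ℕ) - (c i : ℕ) - d * t.val : ℤ) : ZMod N) = 0 := by
      push_cast
      rw [ht, ZMod.natCast_zmod_val, sub_self]
    rw [ZMod.intCast_zmod_eq_zero_iff_dvd] at h0
    rw [Nat.modEq_iff_dvd]
    have h1 := (Int.natCast_dvd_natCast.2 hdN).trans h0
    simpa using dvd_add h1 (Dvd.intro (t.val : ℤ) rfl)
  have hd0 : 1 ≤ d := Nat.pos_of_dvd_of_pos hdN (NeZero.pos N)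
  have hdM : d < M := by
    by_contra! h
    refine hbc (funext fun i => Fin.ext ?_)
    exact (Nat.ModEq.eq_of_lt_of_lt (hmod i) ((c i).2.trans_le h) ((b i).2.trans_le h)).symm
  have hset : (Finset.univ.filter fun x : Fin k → ZMod N =>
      ∑ i, ((b i : ℕ) : ZMod N) * x i = ∑ i, ((c i : ℕ) : ZMod N) * x i) =
      Finset.univ.filter fun x : Fin k → ZMod N =>
        ∑ i, (((b i : ℕ) : ZMod N) - ((c i : ℕ) : ZMod N)) * x i = 0 := by
    ext x
    simp [sub_mul, Finset.sum_sub_distrib, sub_eq_zero]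
  rw [hset]
  refine hd.trans (Nat.mul_le_mul_left _ ?_)
  refine le_trans ?_ (Finset.single_le_sum (fun _ _ => Nat.zero_le _)
    (Finset.mem_Ico.2 ⟨hd0, hdM⟩))
  rw [if_pos hmod]

theorem sum_offDiag_card_le (N M k : ℕ) [NeZero N] :
    (∑ p ∈ (Finset.univ : Finset (Fin k → Fin M)).offDiag,
      (Finset.univ.filter fun x : Fin k → ZMod N =>
        ∑ i, ((p.1 i : ℕ) : ZMod N) * x i = ∑ i, ((p.2 i : ℕ) : ZMod N) * x i).card) * N ≤
      N ^ k * M ^ k * ∑ e ∈ Finset.Ico 1 M, e * (M / e + 1) ^ k := by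
  rw [Finset.sum_mul]
  calc _ ≤ ∑ p ∈ (Finset.univ : Finset (Fin k → Fin M)).offDiag,
        N ^ k * ∑ e ∈ Finset.Ico 1 M, (if ∀ i, (p.2 i : ℕ) ≡ p.1 i [MOD e] then e else 0) :=
        Finset.sum_le_sum fun p hp => card_eq_le_sum (Finset.mem_offDiag.1 hp).2.2
    _ ≤ ∑ p : (Fin k → Fin M) × (Fin k → Fin M),
        N ^ k * ∑ e ∈ Finset.Ico 1 M, (if ∀ i, (p.2 i : ℕ) ≡ p.1 i [MOD e] then e else 0) :=
        Finset.sum_le_sum_of_subset (Finset.subset_univ _)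
    _ ≤ ∑ _b : Fin k → Fin M, N ^ k * ∑ e ∈ Finset.Ico 1 M, e * (M / e + 1) ^ k := by
        rw [Fintype.sum_prod_type]
        refine Finset.sum_le_sum fun b _ => ?_
        rw [← Finset.mul_sum, Finset.sum_comm]
        refine Nat.mul_le_mul_left _ (Finset.sum_le_sum fun e he => ?_)
        rw [← Finset.sum_filter, Finset.sum_const, smul_eq_mul, mul_comm]
        exact Nat.mul_le_mul_left _ (card_forall_modEq_le (Finset.mem_Ico.1 he).1 b)
    _ = _ := by simp; ring

theorem sum_eta (N M k : ℕ) [NeZero N] :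
    ∑ p : (Fin k → ZMod N) × ZMod N, eta N M k p.1 p.2 = N ^ k * M ^ k := by
  rw [Fintype.sum_prod_type]
  have h : ∀ x : Fin k → ZMod N, ∑ w, eta N M k x w = M ^ k := fun x => by
    have := Finset.card_eq_sum_card_fiberwise (s := (Finset.univ : Finset (Fin k → Fin M)))
      (t := Finset.univ) (f := fun b => ∑ i, ((b i : ℕ) : ZMod N) * x i) (by simp)
    simpa [eta] using this.symm
  simp [h]

theorem sum_eta_sq (N M k : ℕ) [NeZero N] :
    ∑ p : (Fin k → ZMod N) × ZMod N, eta N M k p.1 p.2 ^ 2 = N ^ k * M ^ k +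
      ∑ p ∈ (Finset.univ : Finset (Fin k → Fin M)).offDiag,
        (Finset.univ.filter fun x : Fin k → ZMod N =>
          ∑ i, ((p.1 i : ℕ) : ZMod N) * x i = ∑ i, ((p.2 i : ℕ) : ZMod N) * x i).card := by
  have h : ∀ x : Fin k → ZMod N, ∑ w, eta N M k x w ^ 2 =
      ∑ p : (Fin k → Fin M) × (Fin k → Fin M),
        if ∑ i, ((p.1 i : ℕ) : ZMod N) * x i = ∑ i, ((p.2 i : ℕ) : ZMod N) * x i
          then 1 else 0 := fun x => by
    simp only [eta, Finset.card_filter, sq, Finset.sum_mul_sum, Fintype.sum_prod_type]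
    rw [Finset.sum_comm]
    refine Finset.sum_congr rfl fun b _ => ?_
    rw [Finset.sum_comm]
    refine Finset.sum_congr rfl fun c _ => ?_
    simp [eq_comm]
  rw [Fintype.sum_prod_type]
  simp only [h]
  rw [Finset.sum_comm]
  simp only [← Finset.card_filter]
  rw [← Finset.univ_product_univ, ← Finset.diag_union_offDiag,
    Finset.sum_union (Finset.disjoint_diag_offDiag _), Finset.sum_diag]
  simp [mul_comm]

theorem sum_mul_div_add_one_pow_le (M k : ℕ) :
    ((∑ e ∈ Finset.Ico 1 M, e * (M / e + 1) ^ k : ℕ) : ℝ) ≤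
      (M : ℝ) ^ k * ∑ e ∈ Finset.Ico 1 M, (e : ℝ) * (1 / e + 1 / M) ^ k := by
  push_cast
  rw [Finset.mul_sum]
  refine Finset.sum_le_sum fun e he => ?_
  obtain ⟨h1, h2⟩ := Finset.mem_Ico.1 he
  have hM : (0 : ℝ) < M := by exact_mod_cast (by omega : 0 < M)
  have h3 : ((M / e : ℕ) : ℝ) + 1 ≤ M * (1 / e + 1 / M) := by
    have := Nat.cast_div_le (α := ℝ) (m := M) (n := e)
    rw [mul_add, mul_one_div, mul_one_div_cancel hM.ne']
    linarith
  calc (e : ℝ) * (((M / e : ℕ) : ℝ) + 1) ^ k ≤ e * (M * (1 / e + 1 / M)) ^ k := by gcongr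
    _ = _ := by rw [mul_pow]; ring

theorem mul_sixteen_card_le (N M k : ℕ) [NeZero N] (hM : M ^ k ≤ N) :
    16 * (((Finset.univ : Finset ((Fin k → ZMod N) × ZMod N)).filter
      (fun p => 5 ≤ eta N M k p.1 p.2)).card : ℝ) ≤
      (∑ e ∈ Finset.Ico 1 M, (e : ℝ) * (1 / e + 1 / M) ^ k + 1 - (M : ℝ) ^ k / N) *
        (N : ℝ) ^ (k + 1) := by
  have hN : (0 : ℝ) < N := by exact_mod_cast NeZero.pos N
  set S := ∑ e ∈ Finset.Ico 1 M, (e : ℝ) * (1 / e + 1 / M) ^ k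
  have hS : 0 ≤ S := by positivity
  have hoff := sum_offDiag_card_le N M k
  have h1 := sum_eta N M k
  have h2 := sum_eta_sq N M k
  set D := ∑ p ∈ (Finset.univ : Finset (Fin k → Fin M)).offDiag,
      (Finset.univ.filter fun x : Fin k → ZMod N =>
        ∑ i, ((p.1 i : ℕ) : ZMod N) * x i = ∑ i, ((p.2 i : ℕ) : ZMod N) * x i).card
  have hMR : (M : ℝ) ^ k ≤ N := by exact_mod_cast hM
  have hD : (D : ℝ) ≤ S * N ^ (k + 1) := by
    have h3 : (D : ℝ) * N ≤ N ^ k * M ^ k * (M ^ k * S) := by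
      calc (D : ℝ) * N ≤ (N : ℝ) ^ k * M ^ k *
            ((∑ e ∈ Finset.Ico 1 M, e * (M / e + 1) ^ k : ℕ) : ℝ) := by exact_mod_cast hoff
        _ ≤ _ := by gcongr; exact sum_mul_div_add_one_pow_le M k
    refine le_of_mul_le_mul_right (h3.trans ?_) hN
    calc (N : ℝ) ^ k * M ^ k * (M ^ k * S) ≤ N ^ k * N * (N * S) := by gcongr
      _ = _ := by ring
  have h1' : ∑ p : (Fin k → ZMod N) × ZMod N, (eta N M k p.1 p.2 : ℝ) = N ^ k * M ^ k := by
    exact_mod_cast h1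
  have h2' : ∑ p : (Fin k → ZMod N) × ZMod N, (eta N M k p.1 p.2 : ℝ) ^ 2 =
      N ^ k * M ^ k + D := by exact_mod_cast h2
  calc _ = ∑ p ∈ (Finset.univ : Finset ((Fin k → ZMod N) × ZMod N)).filter
          (fun p => 5 ≤ eta N M k p.1 p.2), (16 : ℝ) := by simp [mul_comm]
    _ ≤ ∑ p ∈ (Finset.univ : Finset ((Fin k → ZMod N) × ZMod N)).filter
          (fun p => 5 ≤ eta N M k p.1 p.2), ((eta N M k p.1 p.2 : ℝ) - 1) ^ 2 := by
        refine Finset.sum_le_sum fun p hp => ?_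
        have : (5 : ℝ) ≤ eta N M k p.1 p.2 := by exact_mod_cast (Finset.mem_filter.1 hp).2
        nlinarith
    _ ≤ ∑ p : (Fin k → ZMod N) × ZMod N, ((eta N M k p.1 p.2 : ℝ) - 1) ^ 2 :=
        Finset.sum_le_sum_of_subset_of_nonneg (Finset.filter_subset _ _)
          fun _ _ _ => sq_nonneg _
    _ = ∑ p : (Fin k → ZMod N) × ZMod N, (eta N M k p.1 p.2 : ℝ) ^ 2 -
          2 * ∑ p : (Fin k → ZMod N) × ZMod N, (eta N M k p.1 p.2 : ℝ) + (N : ℝ) ^ (k + 1) := by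
        simp only [sub_sq, mul_one, one_pow, Finset.sum_add_distrib, Finset.sum_sub_distrib,
          Finset.mul_sum]
        simp [pow_succ]
    _ = D - (M : ℝ) ^ k / N * N ^ (k + 1) + N ^ (k + 1) := by
        rw [h1', h2']; field_simp; ring
    _ ≤ _ := by linarith

theorem mul_one_div_pow_le {k : ℕ} (hk : 3 ≤ k) (e : ℕ) :
    (e : ℝ) * (1 / e) ^ k ≤ 1 / (e : ℝ) ^ 2 := by
  rcases Nat.eq_zero_or_pos e with rfl | he
  · simp
  have he' : (1 : ℝ) ≤ e := by exact_mod_cast he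
  calc (e : ℝ) * (1 / e) ^ k ≤ e * (1 / e) ^ 3 := by
        gcongr ?_ * ?_
        exact pow_le_pow_of_le_one (by positivity) ((div_le_one (by positivity)).2 he') hk
    _ = 1 / (e : ℝ) ^ 2 := by field_simp

theorem tendsto_sum_mul_one_div_add_pow {k : ℕ} (hk : 3 ≤ k) :
    Tendsto (fun M : ℕ => ∑ e ∈ Finset.Ico 1 M, (e : ℝ) * (1 / e + 1 / M) ^ k) atTop
      (𝓝 (∑' e : ℕ, (e : ℝ) * (1 / e) ^ k)) := by
  have h := tendsto_tsum_of_dominated_convergence (𝓕 := atTop)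
    (f := fun M e : ℕ => if e ∈ Finset.Ico 1 M then (e : ℝ) * (1 / e + 1 / M) ^ k else 0)
    (g := fun e : ℕ => (e : ℝ) * (1 / e) ^ k)
    (bound := fun e : ℕ => 2 ^ k * (1 / (e : ℝ) ^ 2))
    (hasSum_zeta_two.summable.mul_left _) ?_ ?_
  · refine h.congr fun M => ?_
    rw [tsum_eq_sum (s := Finset.Ico 1 M) fun e he => if_neg he]
    exact Finset.sum_congr rfl fun e he => if_pos he
  · intro e
    rcases Nat.eq_zero_or_pos e with rfl | he
    · simp
    have h1 : Tendsto (fun M : ℕ => (e : ℝ) * (1 / e + 1 / (M : ℝ)) ^ k) atTop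
        (𝓝 ((e : ℝ) * (1 / e + 0) ^ k)) :=
      ((tendsto_one_div_atTop_nhds_zero_nat.const_add _).pow k).const_mul _
    rw [add_zero] at h1
    refine h1.congr' ?_
    filter_upwards [eventually_gt_atTop e] with M hM
    rw [if_pos (Finset.mem_Ico.2 ⟨he, hM⟩)]
  · refine Eventually.of_forall fun M e => ?_
    split_ifs with he
    · obtain ⟨h1, h2⟩ := Finset.mem_Ico.1 he
      have he0 : (0 : ℝ) < e := by exact_mod_cast h1
      rw [Real.norm_of_nonneg (by positivity)]
      calc (e : ℝ) * (1 / e + 1 / M) ^ k ≤ e * (1 / e + 1 / e) ^ k := by gcongr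
        _ = 2 ^ k * (e * (1 / e) ^ k) := by rw [← two_mul, mul_pow]; ring
        _ ≤ _ := by gcongr; exact mul_one_div_pow_le hk e
    · rw [norm_zero]; positivity

theorem tsum_mul_one_div_pow_le {k : ℕ} (hk : 3 ≤ k) :
    ∑' e : ℕ, (e : ℝ) * (1 / e) ^ k ≤ Real.pi ^ 2 / 6 := by
  rw [← hasSum_zeta_two.tsum_eq]
  exact Summable.tsum_le_tsum (mul_one_div_pow_le hk)
    (Summable.of_nonneg_of_le (fun e => by positivity) (mul_one_div_pow_le hk)
      hasSum_zeta_two.summable) hasSum_zeta_two.summable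

theorem Mfl_pow_le {k : ℕ} (hk : k ≠ 0) (N : ℕ) : Mfl k N ^ k ≤ N := by
  have h : (Mfl k N : ℝ) ≤ (N : ℝ) ^ ((1 : ℝ) / k) := Nat.floor_le (by positivity)
  have h2 : ((N : ℝ) ^ ((1 : ℝ) / k)) ^ k = N := by
    rw [one_div, Real.rpow_inv_natCast_pow (by positivity) hk]
  have h3 : (Mfl k N : ℝ) ^ k ≤ N := h2 ▸ pow_le_pow_left₀ (by positivity) h k
  exact_mod_cast h3

theorem tendsto_rpow_one_div_natCast {k : ℕ} (hk : k ≠ 0) :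
    Tendsto (fun N : ℕ => (N : ℝ) ^ ((1 : ℝ) / k)) atTop atTop :=
  (tendsto_rpow_atTop (by positivity)).comp tendsto_natCast_atTop_atTop

theorem tendsto_Mfl_atTop {k : ℕ} (hk : k ≠ 0) : Tendsto (Mfl k) atTop atTop :=
  tendsto_nat_floor_atTop.comp (tendsto_rpow_one_div_natCast hk)

theorem tendsto_Mfl_pow_div {k : ℕ} (hk : k ≠ 0) :
    Tendsto (fun N : ℕ => (Mfl k N : ℝ) ^ k / N) atTop (𝓝 1) := by
  have h := ((tendsto_nat_floor_div_atTop (R := ℝ)).comp (tendsto_rpow_one_div_natCast hk)).pow k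
  rw [one_pow] at h
  refine h.congr fun N => ?_
  rw [Function.comp_apply, div_pow, one_div, Real.rpow_inv_natCast_pow (by positivity) hk, Mfl,
    one_div]

/-- For fixed `k ≥ 3` and `M = ⌊N^(1/k)⌋`, the number of pairs `(x, w)` with
`η^x_w ≥ 5` is at most `(π²/96 + ε) N^(k+1)` for all sufficiently large `N`. -/
theorem eta_few_large_instances (k : ℕ) (hk : 3 ≤ k) (ε : ℝ) (hε : 0 < ε) :
    ∃ N₀ : ℕ, ∀ (N : ℕ) [NeZero N], N₀ ≤ N →
      (((Finset.univ : Finset ((Fin k → ZMod N) × ZMod N)).filter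
          (fun p => 5 ≤ eta N (Mfl k N) k p.1 p.2)).card : ℝ) ≤
        (Real.pi ^ 2 / 96 + ε) * (N : ℝ) ^ (k + 1) := by
  have hk0 : k ≠ 0 := by omega
  have hlim := (((tendsto_sum_mul_one_div_add_pow hk).comp (tendsto_Mfl_atTop hk0)).add_const
    1).sub (tendsto_Mfl_pow_div hk0)
  have hlt : ∑' e : ℕ, (e : ℝ) * (1 / e) ^ k + 1 - 1 < Real.pi ^ 2 / 6 + 16 * ε := by
    linarith [tsum_mul_one_div_pow_le hk]
  obtain ⟨N₀, hN₀⟩ := eventually_atTop.1 (hlim.eventually_le_const hlt)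
  refine ⟨N₀, fun N _ hN => ?_⟩
  have h1 := mul_sixteen_card_le N (Mfl k N) k (Mfl_pow_le hk0 N)
  have h2 := mul_le_mul_of_nonneg_right (hN₀ N hN) (by positivity : (0 : ℝ) ≤ (N : ℝ) ^ (k + 1))
  simp only [Function.comp_apply] at h2
  linarith
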